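/- If a and b are odd natural numbers and c is an even natural number, then Player 1 has a winning strategy in the (a,b,c)-game; that is, the state with a ones, b twos, and c threes is a first-player win in the reversed Zeckendorf game. -/

import Mathlib

/-- The Fibonacci numbers indexed so that `zfib 1 = 1`, `zfib 2 = 2`,
and `zfib (i+1) = zfib i + zfib (i-1)`. -/
def zfib (i : ℕ) : ℕ := Nat.fib (i + 1)

/-- A game state: a finitely supported function recording the height of each bin.
Bin indices start at `1`; index `0` is unused. -/
abbrev ZState := ℕ →₀ ℕ

/-- The legal moves of the reversed Zeckendorf game. -/
inductive ZMove : ZState → ZState → Prop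
  | split (h : ZState) (i : ℕ) (hi : 2 ≤ i) (hpos : 0 < h (i + 1)) :
      ZMove h (h - Finsupp.single (i + 1) 1 + Finsupp.single i 1 + Finsupp.single (i - 1) 1)
  | splitTwo (h : ZState) (hpos : 0 < h 2) :
      ZMove h (h - Finsupp.single 2 1 + Finsupp.single 1 2)
  | combine (h : ZState) (i : ℕ) (hi : 2 < i) (h1 : 0 < h (i + 1)) (h2 : 0 < h (i - 2)) :
      ZMove h (h - Finsupp.single (i + 1) 1 - Finsupp.single (i - 2) 1 + Finsupp.single i 2)
  | combineTwo (h : ZState) (h1 : 0 < h 3) (h2 : 0 < h 1) :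
      ZMove h (h - Finsupp.single 3 1 - Finsupp.single 1 1 + Finsupp.single 2 2)

mutual
  /-- The state is a first-player win: some legal move leads to a state that is a
  loss for the player then to move. -/
  inductive ZFirstWin : ZState → Prop
    | intro (h h' : ZState) (m : ZMove h h') (hl : ZLoss h') : ZFirstWin h
  /-- The state is a loss for the player to move (i.e., not a first-player win):
  every legal move leads to a first-player win for the opponent. -/
  inductive ZLoss : ZState → Prop
    | intro (h : ZState) (hall : ∀ h', ZMove h h' → ZFirstWin h') : ZLoss h
end

/-- The starting state of the `(a,b,c)`-game: `a` ones, `b` twos and `c` threes. -/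
noncomputable def abcState (a b c : ℕ) : ZState :=
  Finsupp.single 1 a + Finsupp.single 2 b + Finsupp.single 3 c

theorem abc_apply (a b c n : ℕ) : abcState a b c n =
    (if n = 1 then a else 0) + (if n = 2 then b else 0) + (if n = 3 then c else 0) := by
  simp [abcState, Finsupp.single_apply, eq_comm]

theorem mv_split (a b c : ℕ) : ZMove (abcState a b (c+1)) (abcState (a+1) (b+1) c) := by
  have h := ZMove.split (abcState a b (c+1)) 2 le_rfl (by simp [abc_apply])
  convert h using 1
  ext n
  simp only [abc_apply, Finsupp.add_apply, Finsupp.tsub_apply, Finsupp.single_apply]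
  grind

theorem mv_two (a b c : ℕ) : ZMove (abcState a (b+1) c) (abcState (a+2) b c) := by
  have h := ZMove.splitTwo (abcState a (b+1) c) (by simp [abc_apply])
  convert h using 1
  ext n
  simp only [abc_apply, Finsupp.add_apply, Finsupp.tsub_apply, Finsupp.single_apply]
  grind

theorem mv_comb (a b c : ℕ) : ZMove (abcState (a+1) b (c+1)) (abcState a (b+2) c) := by
  have h := ZMove.combineTwo (abcState (a+1) b (c+1)) (by simp [abc_apply]) (by simp [abc_apply])
  convert h using 1
  ext n
  simp only [abc_apply, Finsupp.add_apply, Finsupp.tsub_apply, Finsupp.single_apply]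
  grind

theorem mv_inv (a b c : ℕ) (h' : ZState) (m : ZMove (abcState a b c) h') :
    (0 < c ∧ h' = abcState (a+1) (b+1) (c-1)) ∨ (0 < b ∧ h' = abcState (a+2) (b-1) c) ∨
    (0 < a ∧ 0 < c ∧ h' = abcState (a-1) (b+2) (c-1)) := by
  cases m with
  | split i hi hpos =>
    have : i = 2 := by rw [abc_apply] at hpos; grind
    subst this
    refine Or.inl ⟨by simpa [abc_apply] using hpos, ?_⟩
    ext n
    simp only [abc_apply, Finsupp.add_apply, Finsupp.tsub_apply, Finsupp.single_apply]
    grind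
  | splitTwo hpos =>
    refine Or.inr (Or.inl ⟨by simpa [abc_apply] using hpos, ?_⟩)
    ext n
    simp only [abc_apply, Finsupp.add_apply, Finsupp.tsub_apply, Finsupp.single_apply]
    grind
  | combine i hi h1 h2 =>
    exfalso
    rw [abc_apply] at h1
    grind
  | combineTwo h1 h2 =>
    refine Or.inr (Or.inr ⟨by simpa [abc_apply] using h2, by simpa [abc_apply] using h1, ?_⟩)
    ext n
    simp only [abc_apply, Finsupp.add_apply, Finsupp.tsub_apply, Finsupp.single_apply]
    grind

theorem win_of_loss (N a b c : ℕ) (hN : 3 * c + b ≤ N) (hb : b % 2 = 1)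
    (ih : ∀ a b c, 3 * c + b < N → b % 2 = 0 → min a c % 2 = 0 → ZLoss (abcState a b c)) :
    ZFirstWin (abcState a b c) := by
  obtain ⟨b, rfl⟩ : ∃ k, b = k + 1 := ⟨b - 1, by omega⟩
  by_cases h : min (a+2) c % 2 = 0
  · exact .intro _ _ (mv_two a b c) (ih _ _ _ (by omega) (by omega) h)
  · obtain ⟨c, rfl⟩ : ∃ k, c = k + 1 := ⟨c - 1, by omega⟩
    exact .intro _ _ (mv_split a (b+1) c) (ih _ _ _ (by omega) (by omega) (by omega))

theorem loss_abc (N : ℕ) : ∀ a b c, 3 * c + b < N → b % 2 = 0 → min a c % 2 = 0 →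
    ZLoss (abcState a b c) := by
  induction N with
  | zero => intro a b c h; omega
  | succ N ih =>
    intro a b c hN hb hm
    refine .intro _ fun h' m => ?_
    rcases mv_inv a b c h' m with ⟨hc, rfl⟩ | ⟨hb', rfl⟩ | ⟨ha, hc, rfl⟩
    · exact win_of_loss N _ _ _ (by omega) (by omega) ih
    · exact win_of_loss N _ _ _ (by omega) (by omega) ih
    · obtain ⟨a, rfl⟩ : ∃ k, a = k + 2 := ⟨a - 2, by omega⟩
      obtain ⟨c, rfl⟩ : ∃ k, c = k + 2 := ⟨c - 2, by omega⟩
      exact .intro _ _ (mv_comb a (b+2) c) (ih _ _ _ (by omega) (by omega) (by omega))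

theorem abcGame_odd_odd_even_firstPlayerWin (a b c : ℕ) (ha : Odd a) (hb : Odd b) (hc : Even c) :
    ZFirstWin (abcState a b c) := by
  exact win_of_loss _ a b c le_rfl (Nat.odd_iff.mp hb) (loss_abc _)
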